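/- Theorem 1 (ε-point-wise lower bound of SCQ in a linear MDP, full pipeline): assume dvec i > 0 for all i, G = Φᵀ D Φ is invertible, the penalty weights satisfy p i ≥ 0 for all i, and let O ⊆ I (the out-of-distribution pairs), ε ≥ 0, and q : I → ℝ (the true Q-function). Write v = P_Φ (p ⊘ dvec). Suppose (i) v i > 0 for every i ∈ O; (ii) v i = 0 for every i ∉ O; and (iii) |(P_Φ y) i − q i| ≤ ε for every i ∉ O (the sampling/interpolation error assumption). Then there exists α ≥ 0 such that the SCQ Q-value estimate q̂ = Φ G⁻¹ (Φᵀ D y − α · Φᵀ p) satisfies q̂ i ≤ q i + ε for every i ∈ I. -/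

import Mathlib

open Matrix

/-- Theorem 1 (ε-point-wise lower bound of SCQ in a linear MDP, full pipeline): with
`dvec` entrywise positive, `G = Φᵀ D Φ` invertible, nonnegative penalty weights `p`,
OOD set `O`, `ε ≥ 0`, true Q-function `q`, and `v = P_Φ (p ⊘ dvec)` (where
`P_Φ = Φ G⁻¹ Φᵀ D`), suppose `v i > 0` on `O`, `v i = 0` off `O`, and
`|(P_Φ y) i − q i| ≤ ε` off `O`. Then there exists `α ≥ 0` such that the SCQ Q-value
estimate `q̂ = Φ G⁻¹ (Φᵀ D y − α · Φᵀ p)` satisfies `q̂ i ≤ q i + ε` for every `i`. -/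
theorem scq_epsilon_pointwise_lower_bound {I : Type*} [Fintype I] [Nonempty I] [DecidableEq I]
    (m : ℕ) (Φ : Matrix I (Fin m) ℝ) (dvec : I → ℝ) (hd : ∀ i, 0 < dvec i)
    (G : Matrix (Fin m) (Fin m) ℝ) (hGdef : G = Φᵀ * Matrix.diagonal dvec * Φ)
    (hG : IsUnit G.det)
    (PΦ : Matrix I I ℝ) (hPΦ : PΦ = Φ * G⁻¹ * Φᵀ * Matrix.diagonal dvec)
    (p : I → ℝ) (hp : ∀ i, 0 ≤ p i)
    (O : Set I) (ε : ℝ) (hε : 0 ≤ ε) (q y : I → ℝ)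
    (v : I → ℝ) (hv : v = PΦ.mulVec (fun i => p i / dvec i))
    (hvO : ∀ i ∈ O, 0 < v i) (hvOc : ∀ i ∉ O, v i = 0)
    (herr : ∀ i ∉ O, |(PΦ.mulVec y) i - q i| ≤ ε) :
    ∃ α : ℝ, 0 ≤ α ∧ ∀ i : I,
      (Φ.mulVec (G⁻¹.mulVec ((Φᵀ * Matrix.diagonal dvec).mulVec y - α • Φᵀ.mulVec p))) i
        ≤ q i + ε := by
  have hp_eq : Matrix.diagonal dvec *ᵥ (fun i => p i / dvec i) = p := by
    ext i
    rw [Matrix.mulVec_diagonal, mul_div_cancel₀ _ (hd i).ne']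
  have hq (α : ℝ) : Φ *ᵥ (G⁻¹ *ᵥ ((Φᵀ * Matrix.diagonal dvec) *ᵥ y - α • Φᵀ *ᵥ p))
      = PΦ *ᵥ y - α • v := by
    have hv' : v = Φ *ᵥ (G⁻¹ *ᵥ (Φᵀ *ᵥ p)) := by
      rw [hv, hPΦ, ← Matrix.mulVec_mulVec, hp_eq]
      simp only [Matrix.mulVec_mulVec, Matrix.mul_assoc]
    rw [hv', hPΦ]
    simp only [Matrix.mulVec_sub, Matrix.mulVec_smul, Matrix.mulVec_mulVec, Matrix.mul_assoc]
  have hterm (j : I) : 0 ≤ |(PΦ *ᵥ y) j - q j| / |v j| := by positivity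
  refine ⟨∑ j, |(PΦ *ᵥ y) j - q j| / |v j|, Finset.sum_nonneg fun j _ => hterm j, fun i => ?_⟩
  rw [hq, Pi.sub_apply, Pi.smul_apply, smul_eq_mul]
  by_cases hi : i ∈ O
  · have hle : |(PΦ *ᵥ y) i - q i| / |v i| ≤ ∑ j, |(PΦ *ᵥ y) j - q j| / |v j| :=
      Finset.single_le_sum (f := fun j => |(PΦ *ᵥ y) j - q j| / |v j|)
        (fun j _ => hterm j) (Finset.mem_univ i)
    rw [abs_of_pos (hvO i hi), div_le_iff₀ (hvO i hi)] at hle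
    linarith [le_abs_self ((PΦ *ᵥ y) i - q i)]
  · rw [hvOc i hi]
    linarith [(abs_le.mp (herr i hi)).2]
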